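/- Let λ > 0, L > 0, define μ_k = L² k₁²/(4π² k₂²) + 4π² λ k₂² − 1 for k ∈ ℤ² with k₂ ≠ 0, and let m = (m₁,m₂) with m₁, m₂ ≥ 1 integers satisfying m₂ ≥ max{ m₁, L/(2π²√λ) }. Let Z²₊ = {(k₁,k₂) ∈ ℤ² : k₁ ≥ 0, k₂ > 0}, F_{nm} = {k ∈ Z²₊ : k₁ < n m₁, k₂ < n m₂}, I_{nm} = Z²₊ \ F_{nm}, R_n = F_{(n+1)m} \ F_{nm}, and F_m^± = {k ∈ ℤ² : |k₁| < m₁, 0 < |k₂| < m₂}. Then for every q ∈ I_{3m} there exists q̂ ∈ R₂ such that μ_{p+q̂} ≤ μ_{p+q} for all p ∈ F_m^±. -/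

import Mathlib

open Real

/-- The symbol `μ_k = L² k₁²/(4π² k₂²) + 4π² λ k₂² − 1`. -/
noncomputable def mu (lam L : ℝ) (k : ℤ × ℤ) : ℝ :=
  L ^ 2 * (k.1 : ℝ) ^ 2 / (4 * π ^ 2 * (k.2 : ℝ) ^ 2) + 4 * π ^ 2 * lam * (k.2 : ℝ) ^ 2 - 1

theorem mu_le_mu_of_sq_le {lam L : ℝ} {a a' b : ℤ} (h : a ^ 2 ≤ a' ^ 2) :
    mu lam L (a, b) ≤ mu lam L (a', b) := by
  have h' : (a : ℝ) ^ 2 ≤ (a' : ℝ) ^ 2 := by exact_mod_cast h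
  unfold mu
  dsimp only
  gcongr

theorem mu_le_mu_of_le {lam L : ℝ} {a b c : ℤ} (hb : 0 < b) (hbc : b ≤ c)
    (h : L ^ 2 * (a : ℝ) ^ 2 ≤ 16 * π ^ 4 * lam * ((b : ℝ) * c) ^ 2) :
    mu lam L (a, b) ≤ mu lam L (a, c) := by
  have hb' : (0 : ℝ) < b := by exact_mod_cast hb
  have hbc' : (b : ℝ) ≤ c := by exact_mod_cast hbc
  have hc' : (0 : ℝ) < c := hb'.trans_le hbc'
  have hπ := Real.pi_pos
  have key : mu lam L (a, c) - mu lam L (a, b) =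
      ((c : ℝ) ^ 2 - (b : ℝ) ^ 2) *
        (16 * π ^ 4 * lam * ((b : ℝ) * c) ^ 2 - L ^ 2 * (a : ℝ) ^ 2) /
        (4 * π ^ 2 * ((b : ℝ) * c) ^ 2) := by
    unfold mu
    dsimp only
    field_simp
    ring
  have hsq : (b : ℝ) ^ 2 ≤ (c : ℝ) ^ 2 := by gcongr
  have : 0 ≤ mu lam L (a, c) - mu lam L (a, b) := by
    rw [key]
    exact div_nonneg (mul_nonneg (sub_nonneg.2 hsq) (sub_nonneg.2 h)) (by positivity)
  linarith

/-- Key claim in the proof of the first technical lemma of the paper: under the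
truncation condition `m₂ ≥ max{m₁, L/(2π²√λ)}`, for every `q` in the tail
`I_{3m} = Z²₊ \ F_{3m}` there exists `q̂` in the ring `R₂ = F_{3m} \ F_{2m}` such
that `μ_{p+q̂} ≤ μ_{p+q}` for all `p ∈ F_m^±`. -/
theorem tail_reduces_to_ring (lam L : ℝ) (hlam : 0 < lam) (hL : 0 < L)
    (m₁ m₂ : ℤ) (hm₁ : 1 ≤ m₁) (hm₂ : 1 ≤ m₂) (hm₁₂ : m₁ ≤ m₂)
    (hcond : L / (2 * π ^ 2 * Real.sqrt lam) ≤ (m₂ : ℝ)) :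
    ∀ q : ℤ × ℤ, 0 ≤ q.1 → 0 < q.2 → ¬(q.1 < 3 * m₁ ∧ q.2 < 3 * m₂) →
      ∃ qh : ℤ × ℤ, (0 ≤ qh.1 ∧ 0 < qh.2 ∧ qh.1 < 3 * m₁ ∧ qh.2 < 3 * m₂ ∧
          ¬(qh.1 < 2 * m₁ ∧ qh.2 < 2 * m₂)) ∧
        ∀ p : ℤ × ℤ, |p.1| < m₁ → 0 < |p.2| → |p.2| < m₂ →
          mu lam L (p + qh) ≤ mu lam L (p + q) := by
  have hLsq : L ^ 2 ≤ 4 * π ^ 4 * lam * (m₂ : ℝ) ^ 2 := by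
    have hs : 0 < Real.sqrt lam := Real.sqrt_pos.2 hlam
    rw [div_le_iff₀ (by positivity)] at hcond
    calc L ^ 2 ≤ ((m₂ : ℝ) * (2 * π ^ 2 * Real.sqrt lam)) ^ 2 := by gcongr
      _ = 4 * π ^ 4 * Real.sqrt lam ^ 2 * (m₂ : ℝ) ^ 2 := by ring
      _ = _ := by rw [Real.sq_sqrt hlam.le]
  rintro ⟨q₁, q₂⟩ hq₁ hq₂ hq
  dsimp only at hq₁ hq₂ hq
  by_cases h₂ : q₂ < 3 * m₂
  · refine ⟨(2 * m₁, q₂), ⟨by grind, hq₂, by grind, h₂, by grind⟩, ?_⟩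
    rintro ⟨p₁, p₂⟩ hp₁ - -
    have hp := abs_lt.1 hp₁
    dsimp only at hp
    exact mu_le_mu_of_sq_le (pow_le_pow_left₀ (by grind) (by grind) 2)
  · refine ⟨(min q₁ (2 * m₁), 2 * m₂), ⟨by grind, by grind, by grind, by grind, by grind⟩, ?_⟩
    rintro ⟨p₁, p₂⟩ hp₁ - hp₂
    have hp := abs_lt.1 hp₁
    have hp' := abs_lt.1 hp₂
    dsimp only at hp hp'
    have ha : (p₁ + min q₁ (2 * m₁)) ^ 2 ≤ (3 * m₂) ^ 2 :=
      sq_le_sq' (by grind) (by grind)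
    have hbc : m₂ * (2 * m₂) ≤ (p₂ + 2 * m₂) * (p₂ + q₂) :=
      mul_le_mul (by grind) (by grind) (by grind) (by grind)
    have ha' : ((p₁ + min q₁ (2 * m₁) : ℤ) : ℝ) ^ 2 ≤ (3 * (m₂ : ℝ)) ^ 2 := by
      exact_mod_cast ha
    have hbc' : (m₂ : ℝ) * (2 * m₂) ≤ ((p₂ + 2 * m₂ : ℤ) : ℝ) * ((p₂ + q₂ : ℤ) : ℝ) := by
      exact_mod_cast hbc
    have hm : (0 : ℝ) < m₂ := by exact_mod_cast hm₂
    refine (mu_le_mu_of_le (c := p₂ + q₂) (by grind) (by grind) ?_).trans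
      (mu_le_mu_of_sq_le ?_)
    · calc L ^ 2 * ((p₁ + min q₁ (2 * m₁) : ℤ) : ℝ) ^ 2
          ≤ 4 * π ^ 4 * lam * (m₂ : ℝ) ^ 2 * (3 * (m₂ : ℝ)) ^ 2 := by gcongr
        _ = 36 * (π ^ 4 * lam * (m₂ : ℝ) ^ 4) := by ring
        _ ≤ 64 * (π ^ 4 * lam * (m₂ : ℝ) ^ 4) := by gcongr; norm_num
        _ = 16 * π ^ 4 * lam * ((m₂ : ℝ) * (2 * m₂)) ^ 2 := by ring
        _ ≤ _ := by gcongr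
    · rcases le_total q₁ (2 * m₁) with h | h
      · rw [min_eq_left h]
      · rw [min_eq_right h]
        exact pow_le_pow_left₀ (by grind) (by grind) 2
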